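/- arXiv:1109.4984 — 6 statements merged into one kernel-verified Lean document; each statement's English description precedes it below -/
import Mathlib

section
/- Identify ℝ × [0,1] with the closed strip S = { z ∈ ℂ : 0 ≤ Im z ≤ 1 } via (s,t) ↦ s + it. Let v : S → ℂ be a continuous map and let U ⊆ ℂ be an open connected set. Assume: (i) the image of v meets U, and v is holomorphic over U, i.e. v is complex differentiable at every point of v⁻¹(U) (by (iii) this set is contained in the open strip, and it is open in ℂ); (ii) there exist points p, q ∈ ℂ with p ∉ U and q ∉ U such that v(s + it) → p as s → +∞ and v(s + it) → q as s → −∞, uniformly in t ∈ [0,1], and the set v(S) ∪ {p, q} ⊆ ℂ is compact; (iii) v(s) ∉ U and v(s + i) ∉ U for all s ∈ ℝ. Then U ⊆ v(S). In particular, U is bounded. -/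
/-!
Statement 1 (Biran–Cornea, "Lagrangian cobordism I", Remark on the open mapping
theorem): a continuous map `v` on the closed strip `S = ℝ × [0,1] ⊂ ℂ`, holomorphic
over an open connected set `U` that its image meets, with limits `p, q ∉ U` at `±∞`
(uniformly, with compact closed image) and boundary values outside `U`, must cover `U`;
in particular `U` is bounded.
-/

open Complex Set

/-- Identify `ℝ × [0,1]` with the closed strip
`S = {z ∈ ℂ : 0 ≤ Im z ≤ 1}` via `(s,t) ↦ s + it`. Let `v : S → ℂ` be continuous and
`U ⊆ ℂ` open and connected. Assume: (i) the image of `v` meets `U` and `v` is complex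
differentiable at every point of `v⁻¹(U)`; (ii) there are `p, q ∉ U` with
`v(s+it) → p` as `s → +∞` and `v(s+it) → q` as `s → -∞`, uniformly in `t ∈ [0,1]`,
and `v(S) ∪ {p,q}` is compact; (iii) `v(s) ∉ U` and `v(s+i) ∉ U` for all `s ∈ ℝ`.
Then `U ⊆ v(S)`; in particular `U` is bounded. -/
theorem strip_open_mapping_covers
    (v : ℂ → ℂ) (U : Set ℂ) (hUopen : IsOpen U) (hUconn : IsConnected U)
    (hvcont : ContinuousOn v {z : ℂ | 0 ≤ z.im ∧ z.im ≤ 1})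
    -- (i)
    (hmeet : (v '' {z : ℂ | 0 ≤ z.im ∧ z.im ≤ 1} ∩ U).Nonempty)
    (hhol : ∀ z : ℂ, 0 ≤ z.im ∧ z.im ≤ 1 → v z ∈ U → DifferentiableAt ℂ v z)
    -- (ii)
    (p q : ℂ) (hp : p ∉ U) (hq : q ∉ U)
    (hlimp : ∀ ε > (0 : ℝ), ∃ M : ℝ, ∀ s : ℝ, M ≤ s → ∀ t ∈ Set.Icc (0 : ℝ) 1,
      dist (v ((s : ℂ) + (t : ℂ) * Complex.I)) p < ε)
    (hlimq : ∀ ε > (0 : ℝ), ∃ M : ℝ, ∀ s : ℝ, s ≤ M → ∀ t ∈ Set.Icc (0 : ℝ) 1,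
      dist (v ((s : ℂ) + (t : ℂ) * Complex.I)) q < ε)
    (hcpt : IsCompact (v '' {z : ℂ | 0 ≤ z.im ∧ z.im ≤ 1} ∪ {p, q}))
    -- (iii)
    (hbdry : ∀ s : ℝ, v (s : ℂ) ∉ U ∧ v ((s : ℂ) + Complex.I) ∉ U) :
    U ⊆ v '' {z : ℂ | 0 ≤ z.im ∧ z.im ≤ 1} ∧ Bornology.IsBounded U := by
  set S : Set ℂ := {z : ℂ | 0 ≤ z.im ∧ z.im ≤ 1} with hS
  have hSclosed : IsClosed S :=
    (isClosed_le continuous_const Complex.continuous_im).inter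
      (isClosed_le Complex.continuous_im continuous_const)
  -- points over `U` lie in the open strip
  have hint : ∀ z ∈ S, v z ∈ U → S ∈ nhds z := by
    intro z hz hvz
    have h0 : z.im ≠ 0 := by
      intro h
      apply (hbdry z.re).1
      have : (z.re : ℂ) = z := by apply Complex.ext <;> simp [h]
      rwa [this]
    have h1 : z.im ≠ 1 := by
      intro h
      apply (hbdry z.re).2
      have : (z.re : ℂ) + Complex.I = z := by apply Complex.ext <;> simp [h]
      rwa [this]
    have hl : 0 < z.im := lt_of_le_of_ne hz.1 (Ne.symm h0)
    have hu : z.im < 1 := lt_of_le_of_ne hz.2 h1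
    filter_upwards [Complex.continuous_im.continuousAt.eventually_const_lt hl,
      Complex.continuous_im.continuousAt.eventually_lt_const hu] with y hy1 hy2
    exact ⟨hy1.le, hy2.le⟩
  have han : ∀ z ∈ S, v z ∈ U → AnalyticAt ℂ v z := by
    intro z hz hvz
    rw [Complex.analyticAt_iff_eventually_differentiableAt]
    have hc : ContinuousAt v z := hvcont.continuousAt (hint z hz hvz)
    filter_upwards [hint z hz hvz, hc (hUopen.mem_nhds hvz)] with y hy1 hy2
    exact hhol y hy1 hy2
  -- `v` is nowhere locally constant over `U`
  have hnc : ∀ z ∈ S, v z ∈ U → ¬ ∀ᶠ y in nhds z, v y = v z := by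
    intro z hz hvz hev
    set w := v z with hw
    let B : Set ℂ := {x | ∀ᶠ y in nhds x, y ∈ S ∧ v y = w}
    have hBopen : IsOpen B := isOpen_setOfPred_eventually_nhds
    have hBS : B ⊆ {x | x ∈ S ∧ v x = w} := fun x hx => Filter.Eventually.self_of_nhds hx
    have hBclosed : IsClosed B := by
      rw [← closure_subset_iff_isClosed]
      intro x hx
      have hxS : x ∈ S := closure_minimal (fun y hy => (hBS hy).1) hSclosed hx
      have hxw : v x = w := by
        have hcl : IsClosed (S ∩ v ⁻¹' {w}) :=
          hvcont.preimage_isClosed_of_isClosed hSclosed isClosed_singleton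
        have hsb : B ⊆ S ∩ v ⁻¹' {w} := fun y hy => ⟨(hBS hy).1, (hBS hy).2⟩
        exact (closure_minimal hsb hcl hx).2
      have hxU : v x ∈ U := hxw ▸ hvz
      have hSx := hint x hxS hxU
      rcases (han x hxS hxU).eventually_eq_or_eventually_ne
        (analyticAt_const (v := w)) with h | h
      · filter_upwards [hSx, h] with y h1 h2 using ⟨h1, h2⟩
      · rw [eventually_nhdsWithin_iff] at h
        obtain ⟨y, hy, hyB⟩ := (mem_closure_iff_frequently.1 hx).and_eventually h |>.exists
        by_cases hyx : y = x
        · exact hyx ▸ hy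
        · exact absurd (hBS hy).2 (hyB hyx)
    have hBu : B = univ := IsClopen.eq_univ ⟨hBclosed, hBopen⟩
      ⟨z, by filter_upwards [hint z hz hvz, hev] with y h1 h2 using ⟨h1, h2⟩⟩
    have h2 : (2 * Complex.I) ∈ B := hBu ▸ mem_univ _
    have := (hBS h2).1.2
    norm_num at this
  have hsub : U ⊆ v '' S ∩ U := by
    apply hUconn.isPreconnected.subset_of_closure_inter_subset
    · rw [isOpen_iff_mem_nhds]
      rintro _ ⟨⟨z, hz, rfl⟩, hvz⟩
      refine Filter.inter_mem ?_ (hUopen.mem_nhds hvz)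
      rcases (han z hz hvz).eventually_constant_or_nhds_le_map_nhds with h | h
      · exact absurd h (hnc z hz hvz)
      · exact h (Filter.image_mem_map (hint z hz hvz))
    · obtain ⟨x, hx, hxU⟩ := hmeet
      exact ⟨x, hxU, hx, hxU⟩
    · rintro x ⟨hx, hxU⟩
      have h3 := closure_minimal (fun y hy => Or.inl hy.1) hcpt.isClosed hx
      rcases h3 with h | h | h
      · exact ⟨h, hxU⟩
      · exact absurd (h ▸ hxU) hp
      · exact absurd ((mem_singleton_iff.1 h) ▸ hxU) hq
  exact ⟨fun x hx => (hsub hx).1, hcpt.isBounded.subset fun x hx => Or.inl (hsub hx).1⟩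
end

section
/- Identify ℝ × [0,1] with the closed strip S = { z ∈ ℂ : 0 ≤ Im z ≤ 1 } via (s,t) ↦ s + it. Let v : S → ℂ be continuous on S and holomorphic on the open strip { 0 < Im z < 1 }, and suppose there exist p, q ∈ ℂ such that v(s + it) → p as s → +∞ and v(s + it) → q as s → −∞, uniformly in t ∈ [0,1]. Let F ⊆ ℂ be a closed set with p ∈ F, q ∈ F, and v(s) ∈ F and v(s + i) ∈ F for all s ∈ ℝ. If every connected component of ℂ \ F is unbounded, then v(S) ⊆ F. -/
/-!
Statement 2 (Biran–Cornea, "Lagrangian cobordism I", Lemma 4.2 / `lem:open-mapping`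
variant for strips): a map continuous on the closed strip and holomorphic on the open
strip, with uniform limits `p, q ∈ F` at `±∞` and boundary values in the closed set
`F`, has image in `F` provided all connected components of `ℂ \ F` are unbounded.
-/

open Complex Set

/-- Identify `ℝ × [0,1]` with the closed strip
`S = {z ∈ ℂ : 0 ≤ Im z ≤ 1}` via `(s,t) ↦ s + it`. Let `v : S → ℂ` be continuous on
`S` and holomorphic on the open strip `{0 < Im z < 1}`, and suppose `v(s+it) → p` as
`s → +∞` and `v(s+it) → q` as `s → -∞`, uniformly in `t ∈ [0,1]`. Let `F ⊆ ℂ` be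
closed with `p, q ∈ F` and `v(s), v(s+i) ∈ F` for all `s ∈ ℝ`. If every connected
component of `ℂ \ F` is unbounded, then `v(S) ⊆ F`. -/
theorem strip_image_subset_of_unbounded_components
    (v : ℂ → ℂ)
    (hvcont : ContinuousOn v {z : ℂ | 0 ≤ z.im ∧ z.im ≤ 1})
    (hhol : ∀ z : ℂ, 0 < z.im → z.im < 1 → DifferentiableAt ℂ v z)
    (p q : ℂ)
    (hlimp : ∀ ε > (0 : ℝ), ∃ M : ℝ, ∀ s : ℝ, M ≤ s → ∀ t ∈ Set.Icc (0 : ℝ) 1,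
      dist (v ((s : ℂ) + (t : ℂ) * Complex.I)) p < ε)
    (hlimq : ∀ ε > (0 : ℝ), ∃ M : ℝ, ∀ s : ℝ, s ≤ M → ∀ t ∈ Set.Icc (0 : ℝ) 1,
      dist (v ((s : ℂ) + (t : ℂ) * Complex.I)) q < ε)
    (F : Set ℂ) (hF : IsClosed F) (hpF : p ∈ F) (hqF : q ∈ F)
    (hbdry : ∀ s : ℝ, v (s : ℂ) ∈ F ∧ v ((s : ℂ) + Complex.I) ∈ F)
    (hcomp : ∀ z ∈ Fᶜ, ¬ Bornology.IsBounded (connectedComponentIn Fᶜ z)) :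
    v '' {z : ℂ | 0 ≤ z.im ∧ z.im ≤ 1} ⊆ F := by
  set U : Set ℂ := {z : ℂ | 0 < z.im ∧ z.im < 1} with hU
  have hUopen : IsOpen U :=
    (isOpen_lt continuous_const Complex.continuous_im).inter
      (isOpen_lt Complex.continuous_im continuous_const)
  have hUconv : Convex ℝ U := by
    have h : U = Complex.imLm ⁻¹' Ioo (0 : ℝ) 1 := by ext z; simp [hU]
    rw [h]
    exact (convex_Ioo 0 1).linear_preimage Complex.imLm
  have hzeq : ∀ z : ℂ, ((z.re : ℂ) + (z.im : ℂ) * Complex.I) = z := fun z => Complex.re_add_im z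
  -- points of the strip not mapped to `F` are interior
  have hint : ∀ z : ℂ, 0 ≤ z.im → z.im ≤ 1 → v z ∉ F → z ∈ U := by
    intro z h0 h1 hz
    refine ⟨lt_of_le_of_ne h0 fun h => hz ?_, lt_of_le_of_ne h1 fun h => hz ?_⟩
    · have := (hbdry z.re).1
      have e := hzeq z
      rw [← h] at e
      simp only [Complex.ofReal_zero, zero_mul, add_zero] at e
      rwa [e] at this
    · have := (hbdry z.re).2
      have e := hzeq z
      rw [h] at e
      simp only [Complex.ofReal_one, one_mul] at e
      rwa [e] at this
  have hcover : ∀ ε > (0 : ℝ), ∃ K : Set ℂ, IsCompact K ∧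
      (∀ w ∈ K, w ∉ F → w ∈ v '' U) ∧
      v '' U ⊆ K ∪ (Metric.closedBall p ε ∪ Metric.closedBall q ε) := by
    intro ε hε
    obtain ⟨M, hM⟩ := hlimp ε hε
    obtain ⟨N, hN⟩ := hlimq ε hε
    have hsub : Icc N M ×ℂ Icc (0 : ℝ) 1 ⊆ {z : ℂ | 0 ≤ z.im ∧ z.im ≤ 1} := fun z hz => hz.2
    refine ⟨v '' (Icc N M ×ℂ Icc (0 : ℝ) 1),
      (isCompact_Icc.reProdIm isCompact_Icc).image_of_continuousOn (hvcont.mono hsub), ?_, ?_⟩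
    · rintro _ ⟨z, hz, rfl⟩ hw
      exact ⟨z, hint z (hsub hz).1 (hsub hz).2 hw, rfl⟩
    · rintro _ ⟨z, hz, rfl⟩
      have ht : z.im ∈ Icc (0 : ℝ) 1 := ⟨hz.1.le, hz.2.le⟩
      by_cases h1 : M ≤ z.re
      · have := hM z.re h1 z.im ht
        rw [hzeq] at this
        exact Or.inr (Or.inl this.le)
      by_cases h2 : z.re ≤ N
      · have := hN z.re h2 z.im ht
        rw [hzeq] at this
        exact Or.inr (Or.inr this.le)
      exact Or.inl ⟨z, ⟨⟨(not_le.1 h2).le, (not_le.1 h1).le⟩, ht⟩, rfl⟩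
  rintro _ ⟨z, ⟨hz0, hz1⟩, rfl⟩
  by_contra hzF
  have hzU := hint z hz0 hz1 hzF
  have han : AnalyticOnNhd ℂ v U := DifferentiableOn.analyticOnNhd
    (fun x hx => (hhol x hx.1 hx.2).differentiableWithinAt) hUopen
  rcases han.is_constant_or_isOpen hUconv.isPreconnected with ⟨w, hw⟩ | hopen
  · have hwp : w = p := by
      refine eq_of_forall_dist_le fun ε hε => ?_
      obtain ⟨M, hM⟩ := hlimp ε hε
      have h := hM M le_rfl (1 / 2) ⟨by norm_num, by norm_num⟩
      rw [hw _ (by simp [hU]; norm_num)] at h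
      exact h.le
    exact hzF (by rw [hw z hzU, hwp]; exact hpF)
  · have hVopen : IsOpen (v '' U) := hopen U subset_rfl hUopen
    have hsubV : connectedComponentIn Fᶜ (v z) ⊆ v '' U := by
      refine isPreconnected_connectedComponentIn.subset_of_closure_inter_subset hVopen
        ⟨v z, mem_connectedComponentIn hzF, z, hzU, rfl⟩ ?_
      rintro w ⟨hwcl, hwC⟩
      have hwF : w ∉ F := connectedComponentIn_subset _ _ hwC
      have hp : 0 < dist w p := dist_pos.2 fun h => hwF (h ▸ hpF)
      have hq : 0 < dist w q := dist_pos.2 fun h => hwF (h ▸ hqF)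
      obtain ⟨K, hK, hKF, hVK⟩ := hcover (min (dist w p) (dist w q) / 2) (by positivity)
      have hcl := closure_minimal hVK (hK.isClosed.union
        (Metric.isClosed_closedBall.union Metric.isClosed_closedBall)) hwcl
      have m1 := min_le_left (dist w p) (dist w q)
      have m2 := min_le_right (dist w p) (dist w q)
      rcases hcl with h | h | h
      · exact hKF w h hwF
      · rw [Metric.mem_closedBall] at h
        linarith
      · rw [Metric.mem_closedBall] at h
        linarith
    obtain ⟨K, hK, -, hVK⟩ := hcover 1 one_pos
    exact hcomp (v z) hzF ((hK.isBounded.union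
      (Metric.isBounded_closedBall.union Metric.isBounded_closedBall)).subset (hsubV.trans hVK))
end

section
/- Let f : D̄ → ℂ be a continuous map on the closed unit disk D̄ = { z ∈ ℂ : |z| ≤ 1 } which is holomorphic on the open unit disk { z : |z| < 1 }. Let F ⊆ ℂ be a closed set with f(∂D̄) ⊆ F, where ∂D̄ = { z : |z| = 1 }. If every connected component of ℂ \ F is unbounded, then f(D̄) ⊆ F. -/
/-!
Statement 3: a continuous map on the closed unit disk, holomorphic on the open disk,
whose boundary values lie in a closed set `F` all of whose complementary connected
components are unbounded, maps the whole disk into `F`.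
-/

/-- Let `f : D̄ → ℂ` be continuous on the closed unit disk
`D̄ = {z : |z| ≤ 1}` and holomorphic on the open unit disk. Let `F ⊆ ℂ` be a closed set
with `f(∂D̄) ⊆ F`. If every connected component of `ℂ \ F` is unbounded, then
`f(D̄) ⊆ F`. -/
theorem disk_image_subset_of_unbounded_components
    (f : ℂ → ℂ)
    (hfcont : ContinuousOn f (Metric.closedBall (0 : ℂ) 1))
    (hfhol : DifferentiableOn ℂ f (Metric.ball (0 : ℂ) 1))
    (F : Set ℂ) (hF : IsClosed F)
    (hbdry : f '' Metric.sphere (0 : ℂ) 1 ⊆ F)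
    (hcomp : ∀ z ∈ Fᶜ, ¬ Bornology.IsBounded (connectedComponentIn Fᶜ z)) :
    f '' Metric.closedBall (0 : ℂ) 1 ⊆ F := by
  rintro w ⟨z, hz, rfl⟩
  by_contra hw
  have hz1 : ∀ x ∈ Metric.closedBall (0 : ℂ) 1, f x ∉ F → x ∈ Metric.ball (0 : ℂ) 1 := by
    intro x hx hxF
    rw [← Metric.ball_union_sphere] at hx
    rcases hx with hx | hx
    · exact hx
    · exact absurd (hbdry ⟨x, hx, rfl⟩) hxF
  have hzb := hz1 z hz hw
  have hK : IsCompact (f '' Metric.closedBall (0 : ℂ) 1) :=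
    (isCompact_closedBall 0 1).image_of_continuousOn hfcont
  have han : AnalyticOnNhd ℂ f (Metric.ball (0 : ℂ) 1) :=
    hfhol.analyticOnNhd Metric.isOpen_ball
  rcases han.is_constant_or_isOpen (convex_ball (0 : ℂ) 1).isPreconnected with ⟨c, hc⟩ | hopen
  · have hcl : closure (Metric.ball (0 : ℂ) 1) = Metric.closedBall 0 1 :=
      closure_ball 0 one_ne_zero
    have heq : Set.EqOn f (fun _ => c) (Metric.closedBall (0 : ℂ) 1) :=
      Set.EqOn.of_subset_closure (s := Metric.ball (0 : ℂ) 1) (fun x hx => hc x hx) hfcont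
        continuousOn_const Metric.ball_subset_closedBall hcl.ge
    have h1 : f 1 ∈ F := hbdry ⟨1, by simp, rfl⟩
    have h2 : f 1 = c := heq (by simp)
    have h3 : f z = c := heq hz
    exact hw (by rw [h3, ← h2]; exact h1)
  · have hO : IsOpen (f '' Metric.ball (0 : ℂ) 1) :=
      hopen _ subset_rfl Metric.isOpen_ball
    have hOK : f '' Metric.ball (0 : ℂ) 1 ⊆ f '' Metric.closedBall (0 : ℂ) 1 :=
      Set.image_mono Metric.ball_subset_closedBall
    have hsub : connectedComponentIn Fᶜ (f z) ⊆ f '' Metric.ball (0 : ℂ) 1 := by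
      refine isPreconnected_connectedComponentIn.subset_left_of_subset_union hO
        hK.isClosed.isOpen_compl ?_ ?_ ?_
      · exact Set.disjoint_left.2 fun x hx hx' => hx' (hOK hx)
      · intro x hx
        by_cases hxK : x ∈ f '' Metric.closedBall (0 : ℂ) 1
        · obtain ⟨y, hy, rfl⟩ := hxK
          exact Or.inl ⟨y, hz1 y hy (connectedComponentIn_subset _ _ hx), rfl⟩
        · exact Or.inr hxK
      · exact ⟨f z, mem_connectedComponentIn hw, z, hzb, rfl⟩
    exact hcomp (f z) hw (hK.isBounded.subset (hsub.trans hOK))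
end

section
/- Let n ≥ 1 and let γ : ℝ → ℂ be a smooth curve. Then for every t ∈ ℝ, every x ∈ ℝⁿ with |x| = 1, all s₁, s₂ ∈ ℝ, and all v₁, v₂ ∈ ℝⁿ with ⟨x, v₁⟩ = 0 and ⟨x, v₂⟩ = 0 (Euclidean inner product), one has ω( s₁·γ'(t)·x + γ(t)·v₁ , s₂·γ'(t)·x + γ(t)·v₂ ) = 0. (The vectors appearing here are exactly the images under the differential of the map F(t,x) = γ(t)·x of tangent vectors to ℝ × S^{n−1}; hence the set L = { γ(t)·x : t ∈ ℝ, x ∈ ℝⁿ, |x| = 1 } ⊂ ℂⁿ, the Lagrangian surgery handle, is isotropic.) -/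
/-!
Statement 4 (Biran–Cornea, "Lagrangian cobordism I", §5.1): the Lagrangian surgery
handle `L = {γ(t)·x : t ∈ ℝ, x ∈ S^{n-1}} ⊂ ℂⁿ` is isotropic — the standard symplectic
form `ω(u,w) = Σⱼ Im(conj(uⱼ)·wⱼ)` vanishes on the images of tangent vectors of
`ℝ × S^{n-1}` under the differential of `F(t,x) = γ(t)·x`.
-/

open Complex

/-- Let `n ≥ 1` and `γ : ℝ → ℂ` smooth. For every `t ∈ ℝ`, every
`x ∈ ℝⁿ` with `|x| = 1`, all `s₁, s₂ ∈ ℝ` and all `v₁, v₂ ∈ ℝⁿ` with `⟨x,v₁⟩ = 0` and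
`⟨x,v₂⟩ = 0`, one has `ω(s₁·γ'(t)·x + γ(t)·v₁, s₂·γ'(t)·x + γ(t)·v₂) = 0`, where
`ω(u,w) = Σⱼ Im(conj(uⱼ)·wⱼ)` is the standard symplectic form on `ℂⁿ`. -/
theorem surgery_handle_isotropic
    (n : ℕ) (hn : 1 ≤ n) (γ : ℝ → ℂ) (hγ : ContDiff ℝ (⊤ : ℕ∞) γ)
    (t : ℝ) (x : Fin n → ℝ) (hx : ∑ j, x j ^ 2 = 1)
    (s₁ s₂ : ℝ) (v₁ v₂ : Fin n → ℝ)
    (hv₁ : ∑ j, x j * v₁ j = 0) (hv₂ : ∑ j, x j * v₂ j = 0) :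
    ∑ j, ((starRingEnd ℂ) ((s₁ : ℂ) * deriv γ t * (x j : ℂ) + γ t * (v₁ j : ℂ)) *
        ((s₂ : ℂ) * deriv γ t * (x j : ℂ) + γ t * (v₂ j : ℂ))).im = 0 := by
  have key : ∀ j, ((starRingEnd ℂ) ((s₁ : ℂ) * deriv γ t * (x j : ℂ) + γ t * (v₁ j : ℂ)) *
        ((s₂ : ℂ) * deriv γ t * (x j : ℂ) + γ t * (v₂ j : ℂ))).im =
      ((deriv γ t).re * (γ t).im - (deriv γ t).im * (γ t).re) * s₁ * (x j * v₂ j) -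
      ((deriv γ t).re * (γ t).im - (deriv γ t).im * (γ t).re) * s₂ * (x j * v₁ j) := by
    intro j
    simp only [Complex.mul_im, Complex.mul_re, Complex.add_re, Complex.add_im, Complex.conj_re,
      Complex.conj_im, Complex.ofReal_re, Complex.ofReal_im]
    ring
  rw [Finset.sum_congr rfl (fun j _ => key j), Finset.sum_sub_distrib, ← Finset.mul_sum,
    ← Finset.mul_sum, hv₁, hv₂]
  simp
end

section
/- Let n ≥ 1 and let γ = a + ib : ℝ → ℂ be a handle curve. Define F(t, x) = γ(t)·x ∈ ℂⁿ for t ∈ ℝ and x ∈ ℝⁿ. Then: (a) F is injective on the set { (t, x) : t ∈ ℝ, x ∈ ℝⁿ, |x| = 1 }; (b) for every t ∈ ℝ and every x ∈ ℝⁿ with |x| = 1, the real-linear map sending (s, v), with s ∈ ℝ and v ∈ ℝⁿ satisfying ⟨x, v⟩ = 0, to s·γ'(t)·x + γ(t)·v ∈ ℂⁿ, is injective. (Hence F is an injective immersion of ℝ × S^{n−1} into ℂⁿ, so the surgery handle L = image(F) is an embedded Lagrangian submanifold of ℂⁿ.) -/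
/-!
Statement 5 (Biran–Cornea, "Lagrangian cobordism I", §5.1): the map
`F(t,x) = γ(t)·x`, for a handle curve `γ`, is an injective immersion of `ℝ × S^{n-1}`
into `ℂⁿ`, so the surgery handle `L = image F` is an embedded Lagrangian submanifold.
-/

open Complex

/-- A handle curve: a smooth `γ = a + ib : ℝ → ℂ` with `γ(t) = t` for `t ≤ -1`,
`γ(t) = it` for `t ≥ 1`, and `a'(t) > 0`, `b'(t) > 0` on `(-1, 1)`. -/
def IsHandleCurve (γ : ℝ → ℂ) : Prop :=
  ContDiff ℝ (⊤ : ℕ∞) γ ∧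
    (∀ t : ℝ, t ≤ -1 → γ t = (t : ℂ)) ∧
    (∀ t : ℝ, 1 ≤ t → γ t = (t : ℂ) * Complex.I) ∧
    (∀ t ∈ Set.Ioo (-1 : ℝ) 1, 0 < (deriv γ t).re ∧ 0 < (deriv γ t).im)

lemma handle_hasDerivAt {γ : ℝ → ℂ} (hγ : IsHandleCurve γ) (t : ℝ) :
    HasDerivAt γ (deriv γ t) t :=
  ((hγ.1.differentiable (by simp)) t).hasDerivAt

lemma handle_re_hasDerivAt {γ : ℝ → ℂ} (hγ : IsHandleCurve γ) (t : ℝ) :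
    HasDerivAt (fun t => (γ t).re) (deriv γ t).re t := by
  simpa [Function.comp_def] using
    (Complex.reCLM.hasFDerivAt.comp_hasDerivAt t (handle_hasDerivAt hγ t))

lemma handle_im_hasDerivAt {γ : ℝ → ℂ} (hγ : IsHandleCurve γ) (t : ℝ) :
    HasDerivAt (fun t => (γ t).im) (deriv γ t).im t := by
  simpa [Function.comp_def] using
    (Complex.imCLM.hasFDerivAt.comp_hasDerivAt t (handle_hasDerivAt hγ t))

lemma handle_strictMonoOn {γ : ℝ → ℂ} (hγ : IsHandleCurve γ) :
    StrictMonoOn (fun t => (γ t).re) (Set.Icc (-1) 1) ∧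
    StrictMonoOn (fun t => (γ t).im) (Set.Icc (-1) 1) := by
  constructor
  · refine strictMonoOn_of_deriv_pos (convex_Icc _ _)
      (fun t _ => (handle_re_hasDerivAt hγ t).continuousAt.continuousWithinAt) ?_
    intro t ht
    rw [interior_Icc] at ht
    rw [(handle_re_hasDerivAt hγ t).deriv]
    exact (hγ.2.2.2 t ht).1
  · refine strictMonoOn_of_deriv_pos (convex_Icc _ _)
      (fun t _ => (handle_im_hasDerivAt hγ t).continuousAt.continuousWithinAt) ?_
    intro t ht
    rw [interior_Icc] at ht
    rw [(handle_im_hasDerivAt hγ t).deriv]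
    exact (hγ.2.2.2 t ht).2

lemma handle_sum_strictMono {γ : ℝ → ℂ} (hγ : IsHandleCurve γ) :
    StrictMono (fun t => (γ t).re + (γ t).im) := by
  obtain ⟨hr, hi⟩ := handle_strictMonoOn hγ
  have h1 : StrictMonoOn (fun t => (γ t).re + (γ t).im) (Set.Iic (-1)) := by
    intro s hs t ht hst
    simpa [hγ.2.1 s hs, hγ.2.1 t ht] using hst
  have h3 : StrictMonoOn (fun t => (γ t).re + (γ t).im) (Set.Ici 1) := by
    intro s hs t ht hst
    simpa [hγ.2.2.1 s hs, hγ.2.2.1 t ht] using hst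
  have h2 : StrictMonoOn (fun t => (γ t).re + (γ t).im) (Set.Icc (-1) 1) :=
    fun s hs t ht hst => add_lt_add (hr hs ht hst) (hi hs ht hst)
  have h12 := h1.union h2 isGreatest_Iic (isLeast_Icc (by norm_num))
  rw [Set.Iic_union_Icc_eq_Iic (by norm_num)] at h12
  exact h12.Iic_union_Ici h3

lemma handle_sign {γ : ℝ → ℂ} (hγ : IsHandleCurve γ) (t : ℝ) :
    (γ t).re ≤ 0 ∧ 0 ≤ (γ t).im ∧ γ t ≠ 0 := by
  obtain ⟨hr, hi⟩ := handle_strictMonoOn hγ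
  rcases le_or_gt t (-1) with h | h
  · rw [hγ.2.1 t h]
    refine ⟨by simp; linarith, by simp, ?_⟩
    exact_mod_cast (by linarith : t < 0).ne
  rcases le_or_gt 1 t with h' | h'
  · rw [hγ.2.2.1 t h']
    refine ⟨by simp, by simp; linarith, ?_⟩
    refine mul_ne_zero ?_ Complex.I_ne_zero
    exact_mod_cast (by linarith : 0 < t).ne'
  · have a := hr ⟨h.le, h'.le⟩ ⟨by norm_num, le_rfl⟩ h'
    have b := hi ⟨le_rfl, by norm_num⟩ ⟨h.le, h'.le⟩ h
    simp only [hγ.2.2.1 1 le_rfl] at a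
    simp only [hγ.2.1 (-1) le_rfl] at b
    simp at a b
    refine ⟨a.le, b.le, fun h0 => ?_⟩
    simp [h0] at a

lemma handle_deriv_ne {γ : ℝ → ℂ} (hγ : IsHandleCurve γ) (t : ℝ) : deriv γ t ≠ 0 := by
  rcases le_or_gt t (-1) with h | h
  · have h1 : HasDerivWithinAt γ 1 (Set.Iic t) t :=
      (Complex.ofRealCLM.hasDerivAt (x := t)).hasDerivWithinAt.congr
        (fun s hs => hγ.2.1 s (le_trans hs h)) (hγ.2.1 t h) |>.congr_deriv (by simp)
    rw [(uniqueDiffOn_Iic t t Set.self_mem_Iic).eq_deriv _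
      (handle_hasDerivAt hγ t).hasDerivWithinAt h1]
    exact one_ne_zero
  rcases le_or_gt 1 t with h' | h'
  · have h1 : HasDerivWithinAt γ Complex.I (Set.Ici t) t :=
      ((Complex.ofRealCLM.hasDerivAt (x := t)).mul_const Complex.I).hasDerivWithinAt.congr
        (fun s hs => hγ.2.2.1 s (le_trans h' hs)) (hγ.2.2.1 t h') |>.congr_deriv (by simp)
    rw [(uniqueDiffOn_Ici t t Set.self_mem_Ici).eq_deriv _
      (handle_hasDerivAt hγ t).hasDerivWithinAt h1]
    exact Complex.I_ne_zero
  · intro h0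
    have := (hγ.2.2.2 t ⟨h, h'⟩).1
    simp [h0] at this

lemma dot_real {n : ℕ} (z w : ℂ) (x y u : Fin n → ℝ)
    (h : ∀ j, z * (x j : ℂ) = w * (y j : ℂ)) :
    z * ((∑ j, u j * x j : ℝ) : ℂ) = w * ((∑ j, u j * y j : ℝ) : ℂ) := by
  push_cast
  rw [Finset.mul_sum, Finset.mul_sum]
  refine Finset.sum_congr rfl fun j _ => ?_
  linear_combination (u j : ℂ) * h j

/-- Let `n ≥ 1` and let `γ` be a handle curve; let
`F(t,x) = γ(t)·x ∈ ℂⁿ`. Then: (a) `F` is injective on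
`{(t,x) : t ∈ ℝ, x ∈ ℝⁿ, |x| = 1}`; (b) for every `t` and every unit vector `x`, the
real-linear map `(s,v) ↦ s·γ'(t)·x + γ(t)·v`, defined for `s ∈ ℝ` and `v ⟂ x`, is
injective. Hence `F` is an injective immersion of `ℝ × S^{n-1}` into `ℂⁿ` and the
surgery handle `L = image F` is an embedded Lagrangian submanifold of `ℂⁿ`. -/
theorem surgery_handle_injective_immersion
    (n : ℕ) (hn : 1 ≤ n) (γ : ℝ → ℂ) (hγ : IsHandleCurve γ) :
    -- (a) injectivity of `F`
    (∀ (t₁ t₂ : ℝ) (x₁ x₂ : Fin n → ℝ),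
      ∑ j, x₁ j ^ 2 = 1 → ∑ j, x₂ j ^ 2 = 1 →
      (fun j : Fin n => γ t₁ * (x₁ j : ℂ)) = (fun j : Fin n => γ t₂ * (x₂ j : ℂ)) →
      t₁ = t₂ ∧ x₁ = x₂) ∧
    -- (b) injectivity of the differential on tangent vectors
    (∀ (t : ℝ) (x : Fin n → ℝ), ∑ j, x j ^ 2 = 1 →
      ∀ (s₁ s₂ : ℝ) (v₁ v₂ : Fin n → ℝ),
        ∑ j, x j * v₁ j = 0 → ∑ j, x j * v₂ j = 0 →
        (fun j : Fin n => (s₁ : ℂ) * deriv γ t * (x j : ℂ) + γ t * (v₁ j : ℂ)) =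
          (fun j : Fin n => (s₂ : ℂ) * deriv γ t * (x j : ℂ) + γ t * (v₂ j : ℂ)) →
        s₁ = s₂ ∧ v₁ = v₂) := by
  constructor
  · intro t₁ t₂ x₁ x₂ hx₁ hx₂ h
    have hj := fun j => congrFun h j
    have e1 := dot_real _ _ _ _ x₁ hj
    have e2 := dot_real _ _ _ _ x₂ hj
    have c1 : ∑ j, x₁ j * x₁ j = 1 := by simpa [sq] using hx₁
    have c2 : ∑ j, x₂ j * x₂ j = 1 := by simpa [sq] using hx₂
    have c3 : ∑ j, x₂ j * x₁ j = ∑ j, x₁ j * x₂ j :=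
      Finset.sum_congr rfl fun j _ => mul_comm _ _
    rw [c1] at e1
    rw [c2, c3] at e2
    generalize (∑ j, x₁ j * x₂ j) = c at e1 e2
    obtain ⟨r1, i1, n1⟩ := handle_sign hγ t₁
    obtain ⟨r2, i2, n2⟩ := handle_sign hγ t₂
    have hc : ((c * c : ℝ) : ℂ) = ((1 : ℝ) : ℂ) := by
      apply mul_left_cancel₀ n1
      push_cast at *
      linear_combination (c : ℂ) * e2 - e1
    have hc' : c * c = 1 := Complex.ofReal_injective hc
    have heq : γ t₁ = γ t₂ := by
      rcases mul_self_eq_one_iff.mp hc' with rfl | rfl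
      · simpa using e1
      · exfalso
        have e3 : γ t₁ = - γ t₂ := by simpa using e1
        apply n1
        have hr := congrArg Complex.re e3
        have hi := congrArg Complex.im e3
        simp only [Complex.neg_re, Complex.neg_im] at hr hi
        apply Complex.ext
        · simp only [Complex.zero_re]; linarith
        · simp only [Complex.zero_im]; linarith
    refine ⟨(handle_sum_strictMono hγ).injective (by simp only [heq]), ?_⟩
    funext j
    have := hj j
    rw [heq] at this
    exact Complex.ofReal_injective (mul_left_cancel₀ n2 this)
  · intro t x hx s₁ s₂ v₁ v₂ hv₁ hv₂ h
    have hj := fun j => congrFun h j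
    have n1 := (handle_sign hγ t).2.2
    have n2 := handle_deriv_ne hγ t
    have e := dot_real (((s₁ - s₂ : ℝ) : ℂ) * deriv γ t) (γ t) x (fun j => v₂ j - v₁ j) x
      (fun j => by push_cast; linear_combination hj j)
    have c1 : ∑ j, x j * x j = 1 := by simpa [sq] using hx
    have c2 : ∑ j, x j * (v₂ j - v₁ j) = 0 := by
      simp only [mul_sub, Finset.sum_sub_distrib, hv₁, hv₂, sub_zero]
    rw [c1, c2] at e
    have hs : s₁ = s₂ := by
      have e' : ((s₁ - s₂ : ℝ) : ℂ) * deriv γ t = 0 := by simpa using e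
      have := (mul_eq_zero.mp e').resolve_right n2
      exact sub_eq_zero.mp (Complex.ofReal_eq_zero.mp this)
    refine ⟨hs, ?_⟩
    funext j
    have := hj j
    rw [hs] at this
    exact Complex.ofReal_injective (mul_left_cancel₀ n1 (add_left_cancel this))
end

section
/- Let n ≥ 1 and let γ = a + ib : ℝ → ℂ be a handle curve. Define Ŵ = { γ(t)·x : t ∈ ℝ, x ∈ ℝ^{n+1}, |x| = 1 } ⊆ ℂ^{n+1}, and write points of ℂ^{n+1} as z = (z₁, z') with z₁ ∈ ℂ and z' ∈ ℂⁿ. Then: (a) for every real r ≤ −1, { z ∈ Ŵ : z₁ = r } = { (r, y) : y ∈ ℝⁿ } (here ℝⁿ ⊂ ℂⁿ is the set of vectors with all coordinates real); (b) for every real s ≥ 1, { z ∈ Ŵ : z₁ = is } = { (is, i·y) : y ∈ ℝⁿ }; (c) { z ∈ Ŵ : z₁ = 0 } = { (0, γ(t)·x') : t ∈ ℝ, x' ∈ ℝⁿ, |x'| = 1 }, i.e. the fiber over 0 of the first coordinate projection is {0} × L where L is the n-dimensional surgery handle. (These fiber computations show that the Lagrangian Ŵ restricted over a suitable planar region is a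 Lagrangian cobordism from L to the pair (ℝⁿ, iℝⁿ).) -/
/-!
Statement 6 (Biran–Cornea, "Lagrangian cobordism I", proof of Lemma 5.1 /
`lem:surgery-trace`): computation of the fibers of the first coordinate projection on
the `(n+1)`-dimensional handle `Ŵ = H·Sⁿ ⊂ ℂ^{n+1}` — over `r ≤ -1` the fiber is
`{r} × ℝⁿ`, over `is` with `s ≥ 1` it is `{is} × iℝⁿ`, and over `0` it is `{0} × L`,
`L` the `n`-dimensional surgery handle.
-/

open Complex

/-- The `m`-dimensional surgery handle `γ · S^{m-1} ⊆ ℂᵐ`. -/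
def surgeryHandle (m : ℕ) (γ : ℝ → ℂ) : Set (Fin m → ℂ) :=
  {z | ∃ (t : ℝ) (x : Fin m → ℝ), ∑ j, x j ^ 2 = 1 ∧ z = fun j => γ t * (x j : ℂ)}

/-- On the open interval a handle curve lies in the open second quadrant. -/
lemma IsHandleCurve.mid {γ : ℝ → ℂ} (hγ : IsHandleCurve γ) {t : ℝ} (h1 : -1 < t) (h2 : t < 1) :
    (γ t).re < 0 ∧ 0 < (γ t).im := by
  obtain ⟨hs, hl, hr, hd⟩ := hγ
  have hdiff : Differentiable ℝ γ := hs.differentiable (by simp)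
  have hre : ∀ u, HasDerivAt (fun v => (γ v).re) (deriv γ u).re u := fun u =>
    (Complex.reCLM.hasFDerivAt.comp_hasDerivAt u (hdiff u).hasDerivAt)
  have him : ∀ u, HasDerivAt (fun v => (γ v).im) (deriv γ u).im u := fun u =>
    (Complex.imCLM.hasFDerivAt.comp_hasDerivAt u (hdiff u).hasDerivAt)
  have m1 : StrictMonoOn (fun v => (γ v).re) (Set.Icc (-1) 1) := by
    apply strictMonoOn_of_deriv_pos (convex_Icc _ _)
    · exact fun u _ => (hre u).continuousAt.continuousWithinAt
    · intro u hu
      rw [interior_Icc] at hu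
      rw [(hre u).deriv]
      exact (hd u hu).1
  have m2 : StrictMonoOn (fun v => (γ v).im) (Set.Icc (-1) 1) := by
    apply strictMonoOn_of_deriv_pos (convex_Icc _ _)
    · exact fun u _ => (him u).continuousAt.continuousWithinAt
    · intro u hu
      rw [interior_Icc] at hu
      rw [(him u).deriv]
      exact (hd u hu).2
  have e1 := m1 ⟨h1.le, h2.le⟩ ⟨by norm_num, le_refl _⟩ h2
  have e2 := m2 ⟨le_refl _, by norm_num⟩ ⟨h1.le, h2.le⟩ h1
  simp only [hr 1 le_rfl, hl (-1) le_rfl] at e1 e2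
  constructor
  · simpa using e1
  · simpa using e2

/-- Every vector of norm at least one with first coordinate `r` is `t · x` with `t ≥ 1`
and `x` a unit vector. -/
lemma exists_polar {n : ℕ} (r : ℝ) (hr : 1 ≤ r ^ 2) (y : Fin n → ℝ) :
    ∃ (t : ℝ) (x : Fin (n + 1) → ℝ), 1 ≤ t ∧ ∑ j, x j ^ 2 = 1 ∧ t * x 0 = r ∧
      ∀ j : Fin n, t * x j.succ = y j := by
  have hS : 0 ≤ ∑ j, y j ^ 2 := Finset.sum_nonneg fun j _ => sq_nonneg _
  set S := ∑ j, y j ^ 2 with hSdef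
  have ht : 1 ≤ √(r ^ 2 + S) := Real.one_le_sqrt.2 (by linarith)
  have hsq : √(r ^ 2 + S) ^ 2 = r ^ 2 + S := Real.sq_sqrt (by positivity)
  set t := √(r ^ 2 + S)
  have h0 : t ≠ 0 := by linarith
  refine ⟨t, Fin.cons (r / t) (fun j => y j / t), ht, ?_, ?_, ?_⟩
  · rw [Fin.sum_univ_succ]
    simp only [Fin.cons_zero, Fin.cons_succ, div_pow]
    rw [← Finset.sum_div, ← hSdef, hsq, ← add_div, div_self]
    rw [← hsq]
    positivity
  · simp only [Fin.cons_zero]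
    field_simp
  · intro j
    simp only [Fin.cons_succ]
    field_simp

/-- Let `n ≥ 1`, let `γ` be a handle curve and let
`Ŵ = {γ(t)·x : t ∈ ℝ, x ∈ Sⁿ} ⊆ ℂ^{n+1}`, writing `z = (z₁, z')` with `z₁ ∈ ℂ`,
`z' ∈ ℂⁿ`. Then: (a) for `r ≤ -1`, `{z ∈ Ŵ : z₁ = r} = {(r, y) : y ∈ ℝⁿ}`;
(b) for `s ≥ 1`, `{z ∈ Ŵ : z₁ = is} = {(is, i·y) : y ∈ ℝⁿ}`;
(c) `{z ∈ Ŵ : z₁ = 0} = {0} × L`, where `L` is the `n`-dimensional surgery handle. -/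
theorem surgery_trace_fibers
    (n : ℕ) (hn : 1 ≤ n) (γ : ℝ → ℂ) (hγ : IsHandleCurve γ) :
    -- (a)
    (∀ r : ℝ, r ≤ -1 →
      {z ∈ surgeryHandle (n + 1) γ | z 0 = (r : ℂ)} =
        {z : Fin (n + 1) → ℂ | ∃ y : Fin n → ℝ,
          z = Fin.cons (r : ℂ) (fun j => (y j : ℂ))}) ∧
    -- (b)
    (∀ s : ℝ, 1 ≤ s →
      {z ∈ surgeryHandle (n + 1) γ | z 0 = (s : ℂ) * Complex.I} =
        {z : Fin (n + 1) → ℂ | ∃ y : Fin n → ℝ,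
          z = Fin.cons ((s : ℂ) * Complex.I) (fun j => (y j : ℂ) * Complex.I)}) ∧
    -- (c)
    ({z ∈ surgeryHandle (n + 1) γ | z 0 = 0} =
      {z : Fin (n + 1) → ℂ | ∃ (t : ℝ) (x' : Fin n → ℝ), ∑ j, x' j ^ 2 = 1 ∧
        z = Fin.cons (0 : ℂ) (fun j => γ t * (x' j : ℂ))}) := by
  have hl := hγ.2.1
  have hr := hγ.2.2.1
  refine ⟨?_, ?_, ?_⟩
  · intro r hr1
    ext z
    constructor
    · rintro ⟨⟨t, x, hx, rfl⟩, hz⟩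
      have hz' : γ t * (x 0 : ℂ) = (r : ℂ) := hz
      have zre := congrArg Complex.re hz'
      have zim := congrArg Complex.im hz'
      simp at zre zim
      rcases le_or_gt t (-1) with h1 | h1
      · refine ⟨fun j => t * x j.succ, ?_⟩
        funext j
        refine Fin.cases ?_ (fun j => ?_) j
        · simpa using hz'
        · simp [hl t h1]
      · exfalso
        rcases lt_or_ge t 1 with h2 | h2
        · have := (hγ.mid h1 h2).2
          rcases zim with h | h
          · linarith
          · rw [h] at zre
            linarith
        · rw [hr t h2] at zre
          simp at zre
          linarith
    · rintro ⟨y, rfl⟩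
      refine ⟨?_, by simp⟩
      obtain ⟨t, x, ht, hx, h0, hj⟩ := exists_polar (-r) (by nlinarith) (fun j => - y j)
      refine ⟨-t, x, hx, ?_⟩
      rw [hl (-t) (by linarith)]
      funext j
      refine Fin.cases ?_ (fun j => ?_) j
      · have : r = -t * x 0 := by linarith
        simp only [Fin.cons_zero]
        exact_mod_cast this
      · have : y j = -t * x j.succ := by linarith [hj j]
        simp only [Fin.cons_succ]
        exact_mod_cast this
  · intro s hs1
    ext z
    constructor
    · rintro ⟨⟨t, x, hx, rfl⟩, hz⟩
      have hz' : γ t * (x 0 : ℂ) = (s : ℂ) * Complex.I := hz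
      have zre := congrArg Complex.re hz'
      have zim := congrArg Complex.im hz'
      simp at zre zim
      rcases le_or_gt 1 t with h1 | h1
      · refine ⟨fun j => t * x j.succ, ?_⟩
        funext j
        refine Fin.cases ?_ (fun j => ?_) j
        · simpa using hz'
        · simp only [hr t h1, Fin.cons_succ]
          push_cast
          ring
      · exfalso
        rcases lt_or_ge (-1) t with h2 | h2
        · have := (hγ.mid h2 h1).1
          rcases zre with h | h
          · linarith
          · rw [h] at zim
            linarith
        · rw [hl t h2] at zim
          simp at zim
          linarith
    · rintro ⟨y, rfl⟩
      refine ⟨?_, by simp⟩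
      obtain ⟨t, x, ht, hx, h0, hj⟩ := exists_polar s (by nlinarith) y
      refine ⟨t, x, hx, ?_⟩
      rw [hr t ht]
      funext j
      refine Fin.cases ?_ (fun j => ?_) j
      · simp only [Fin.cons_zero, ← h0]
        push_cast
        ring
      · simp only [Fin.cons_succ, ← hj j]
        push_cast
        ring
  · have hne : ∀ t, γ t ≠ 0 := by
      intro t h
      rcases le_or_gt t (-1) with h1 | h1
      · rw [hl t h1] at h
        have : t = 0 := by exact_mod_cast h
        linarith
      · rcases lt_or_ge t 1 with h2 | h2
        · have := (hγ.mid h1 h2).2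
          rw [h] at this
          simp at this
        · rw [hr t h2] at h
          simp at h
          linarith
    ext z
    constructor
    · rintro ⟨⟨t, x, hx, rfl⟩, hz⟩
      have hz' : γ t * (x 0 : ℂ) = 0 := hz
      have hx0 : x 0 = 0 := by
        rcases mul_eq_zero.1 hz' with h | h
        · exact absurd h (hne t)
        · exact_mod_cast h
      refine ⟨t, fun j => x j.succ, ?_, ?_⟩
      · rw [Fin.sum_univ_succ, hx0] at hx
        simpa using hx
      · funext j
        refine Fin.cases ?_ (fun j => ?_) j
        · simpa using hz'
        · simp
    · rintro ⟨t, x, hx, rfl⟩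
      refine ⟨⟨t, Fin.cons 0 x, ?_, ?_⟩, by simp⟩
      · rw [Fin.sum_univ_succ]
        simpa using hx
      · funext j
        refine Fin.cases ?_ (fun j => ?_) j
        · simp
        · simp
end
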